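/- There is a weight-reversing involution between bad elements: there is a bijection S from the bad elements of C(n) to the bad elements of B(n) such that for every matrix A, the weight of S(π, σ) equals the weight of (π, σ) with opposite sign (where elements of C(n) carry an extra factor −1 in their weight). Consequently, Σ_{bad (π,σ) ∈ B(n)} weight + Σ_{bad (π,σ) ∈ C(n)} weight = 0. -/

import Mathlib

/- We work with `n + 2` people of each sex (so the number of people is at least 2),
men and women both indexed by `Fin (n+2)`; man `0` is "Mr. 1" and man `Fin.last (n+1)`
is "Mr. n", and similarly for women.

A pair `(π, σ)` of total permutations of `Fin (n+2)` encodes an element of one of the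
sets `A(n)`, `B(n)`, `C(n)` of pairs (marriage matching, affair matching) of
Zeilberger's proof, via dummy values at the unused points:
* `A(n)`: `π` is the marriage matching of all men to all women, and the affair
  matching `{2,…,n-1} → {2',…,(n-1)'}` is encoded by a permutation `σ` fixing the
  endpoints `0` and `last`.
* `B(n)`: the marriage matching `{1,…,n-1} → {1',…,(n-1)'}` is encoded by `π` with the
  dummy value `π last = last`, and the affair matching `{2,…,n} → {2',…,n'}` by `σ`
  with dummy value `σ 0 = 0`.
* `C(n)`: the marriage matching `{1,…,n-1} → {2',…,n'}` is encoded by `π` with dummy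
  value `π last = 0`, and the affair matching `{2,…,n} → {1',…,(n-1)'}` by `σ` with
  dummy value `σ 0 = last`. -/

/-- A pair (marriages, affairs) of permutations. -/
abbrev PairPerm (n : ℕ) := Equiv.Perm (Fin (n + 2)) × Equiv.Perm (Fin (n + 2))

/-- The last index (Mr./Ms. `n`). -/
def lastF (n : ℕ) : Fin (n + 2) := Fin.last (n + 1)

/-- The middle indices `{2,…,n-1}` (people having affairs in `A(n)`). -/
def middleF (n : ℕ) : Finset (Fin (n + 2)) := (Finset.univ.erase 0).erase (lastF n)

/-- Membership in `A(n)`: the affair permutation fixes the two endpoints. -/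
def InA {n : ℕ} (p : PairPerm n) : Prop := p.2 0 = 0 ∧ p.2 (lastF n) = lastF n

/-- Membership in `B(n)`: dummy marriage `n ↦ n'`, dummy affair `1 ↦ 1'`. -/
def InB {n : ℕ} (p : PairPerm n) : Prop := p.1 (lastF n) = lastF n ∧ p.2 0 = 0

/-- Membership in `C(n)`: dummy marriage `n ↦ 1'`, dummy affair `1 ↦ n'`. -/
def InC {n : ℕ} (p : PairPerm n) : Prop := p.1 (lastF n) = 0 ∧ p.2 0 = lastF n

/-- The alternating chain of men: `m 0 = n`, and `m (k+1)` is the lover of the wife of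
`m k` (wife: apply `π`; lover: apply `σ⁻¹`). -/
def chainM {n : ℕ} (p : PairPerm n) : ℕ → Fin (n + 2)
  | 0 => lastF n
  | k + 1 => p.2.symm (p.1 (chainM p k))

/-- The alternating chain of women: `w k` is the wife of `m k`. -/
def chainW {n : ℕ} (p : PairPerm n) (k : ℕ) : Fin (n + 2) := p.1 (chainM p k)

/-- `TStep p q` says that `q` is obtained from `p` by Zeilberger's map `T`: along the
alternating chain `m 0 = n, w 0, m 1, w 1, …` of `p`, which terminates at the first
woman `w (r-1) ∈ {1', n'}`, marriages `(m k, w k)` become affairs and affairs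
`(m (k+1), w k)` become marriages; everything off the chain is unchanged, and the
dummy values are set according to whether the chain ended at `1'` or at `n'`. -/
def TStep {n : ℕ} (p q : PairPerm n) : Prop :=
  ∃ r : ℕ, 1 ≤ r ∧
    (∀ k, k + 1 < r → chainW p k ≠ 0 ∧ chainW p k ≠ lastF n) ∧
    (chainW p (r - 1) = 0 ∨ chainW p (r - 1) = lastF n) ∧
    (∀ i, (∀ k, k < r → i ≠ chainM p k) → q.1 i = p.1 i) ∧
    (∀ i, i ≠ 0 → (∀ k, k < r → i ≠ chainM p k) → q.2 i = p.2 i) ∧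
    (∀ k, k + 1 < r → q.1 (chainM p (k + 1)) = chainW p k) ∧
    q.1 (lastF n) = chainW p (r - 1) ∧
    (∀ k, k < r → q.2 (chainM p k) = chainW p k) ∧
    q.2 0 = (if chainW p (r - 1) = 0 then lastF n else 0)

/-- The (unsigned-convention) weight of an element of `B(n) ∪ C(n)`: product of signs
times the products of matrix entries over the marriage edges (men other than `n`) and
the affair edges (men other than `1`).  Elements of `C(n)` carry an extra factor `-1`
on top of this. -/
def wgt {n : ℕ} (R : Type) [CommRing R] (A : Fin (n + 2) → Fin (n + 2) → R)
    (q : PairPerm n) : R :=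
  ((Equiv.Perm.sign q.1 : ℤ) : R) * ((Equiv.Perm.sign q.2 : ℤ) : R) *
    (∏ i ∈ Finset.univ.erase (lastF n), A i (q.1 i)) *
      ∏ i ∈ Finset.univ.erase 0, A i (q.2 i)

/-- An element of `B(n) ∪ C(n)` is bad if it is not in the image of `T`. -/
def IsBad {n : ℕ} (q : PairPerm n) : Prop := ¬∃ p, InA p ∧ TStep p q

/-- Bad element of `B(n)`. -/
def BadB {n : ℕ} (q : PairPerm n) : Prop := InB q ∧ IsBad q

/-- Bad element of `C(n)`. -/
def BadC {n : ℕ} (q : PairPerm n) : Prop := InC q ∧ IsBad q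

lemma lastF_ne_zero (n : ℕ) : lastF n ≠ 0 := Fin.last_pos.ne'

namespace PairPerm

open Equiv Equiv.Perm

variable {n : ℕ}

/-- The permutation `π⁻¹ σ` of the men, precomposed with the swap of the two endpoints. -/
def link (q : PairPerm n) : Perm (Fin (n + 2)) := q.1⁻¹ * q.2 * swap 0 (lastF n)

/-- The cycle of `link q` through the last man. -/
def linkCycle (q : PairPerm n) : Perm (Fin (n + 2)) := (link q).cycleOf (lastF n)

/-- Exchange of marriages and affairs along the cycle `linkCycle q`. -/
def switch (q : PairPerm n) : PairPerm n :=
  (q.1 * linkCycle q,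
    q.2 * swap 0 (lastF n) * (linkCycle q)⁻¹ * swap 0 (lastF n))

lemma fst_link (q : PairPerm n) (i : Fin (n + 2)) :
    q.1 (link q i) = q.2 (swap 0 (lastF n) i) := by
  simp [link]

lemma link_zero (q : PairPerm n) : link q 0 = (q.1⁻¹ * q.2) (lastF n) := by
  simp [link]

lemma link_of_ne (q : PairPerm n) {i : Fin (n + 2)} (h0 : i ≠ 0) (hl : i ≠ lastF n) :
    link q i = (q.1⁻¹ * q.2) i := by
  rw [link, mul_apply, swap_apply_of_ne_of_ne h0 hl]

lemma snd_swap_link_symm (q : PairPerm n) (i : Fin (n + 2)) :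
    q.2 (swap 0 (lastF n) ((link q)⁻¹ i)) = q.1 i := by
  rw [← fst_link]; simp

lemma linkCycle_inv (q : PairPerm n) : (linkCycle q)⁻¹ = (link q)⁻¹.cycleOf (lastF n) :=
  cycleOf_inv _ _

lemma link_switch (q : PairPerm n) :
    link (switch q) = (linkCycle q)⁻¹ * (link q * (linkCycle q)⁻¹) := by
  simp [link, switch, mul_assoc]

lemma commute_linkCycle (q : PairPerm n) : Commute (linkCycle q) (link q) := by
  ext1 i
  simp only [linkCycle, mul_apply, cycleOf_apply, sameCycle_apply_right]
  split_ifs <;> rfl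

lemma linkCycle_switch (q : PairPerm n) : linkCycle (switch q) = (linkCycle q)⁻¹ := by
  have h1 : Commute (linkCycle q)⁻¹ (link q * (linkCycle q)⁻¹) :=
    (commute_linkCycle q).inv_left.mul_right (Commute.refl _)
  have h2 : (link q * (linkCycle q)⁻¹) (lastF n) = lastF n := by
    simp [linkCycle_inv]
  have h3 : (linkCycle q)⁻¹.cycleOf (lastF n) = (linkCycle q)⁻¹ := by
    ext1 i
    rw [cycleOf_apply]
    split_ifs with h
    · rfl
    · rw [linkCycle_inv, cycleOf_apply_of_not_sameCycle]
      rintro ⟨k, hk⟩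
      refine h ⟨k, ?_⟩
      rwa [linkCycle_inv, cycleOf_zpow_apply_self]
  conv_lhs => rw [linkCycle, link_switch]
  rw [cycleOf_mul_of_apply_right_eq_self h1 _ h2, h3]

lemma switch_switch (q : PairPerm n) : switch (switch q) = q := by
  refine Prod.ext ?_ ?_
  · change (switch q).1 * linkCycle (switch q) = q.1
    rw [linkCycle_switch]; simp [switch]
  · change (switch q).2 * _ * (linkCycle (switch q))⁻¹ * _ = q.2
    rw [linkCycle_switch]; simp [switch, mul_assoc]

lemma sameCycle_link_of_switch {q : PairPerm n} {i : Fin (n + 2)}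
    (h : (link (switch q)).SameCycle (lastF n) i) : (link q).SameCycle (lastF n) i := by
  obtain ⟨k, hk⟩ := h
  rw [← cycleOf_zpow_apply_self] at hk
  change (linkCycle (switch q) ^ k) (lastF n) = i at hk
  rw [linkCycle_switch, linkCycle_inv, cycleOf_zpow_apply_self] at hk
  exact sameCycle_inv.1 ⟨k, hk⟩

lemma switch_fst_last (q : PairPerm n) : (switch q).1 (lastF n) = q.2 0 := by
  simp [switch, linkCycle, fst_link]

lemma switch_snd_zero (q : PairPerm n) : (switch q).2 0 = q.1 (lastF n) := by
  simp only [switch, linkCycle_inv, mul_apply, swap_apply_left, cycleOf_apply_self,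
    snd_swap_link_symm]

lemma inC_switch {q : PairPerm n} (h : InB q) : InC (switch q) :=
  ⟨(switch_fst_last q).trans h.2, (switch_snd_zero q).trans h.1⟩

lemma inB_switch {q : PairPerm n} (h : InC q) : InB (switch q) :=
  ⟨(switch_fst_last q).trans h.2, (switch_snd_zero q).trans h.1⟩

lemma sign_switch (q : PairPerm n) :
    sign (switch q).1 * sign (switch q).2 = sign q.1 * sign q.2 := by
  simp only [switch, Perm.sign_mul, Perm.sign_inv]
  generalize sign (swap (0 : Fin (n + 2)) (lastF n)) = b
  generalize sign (linkCycle q) = a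
  rcases Int.units_eq_one_or a with rfl | rfl <;> rcases Int.units_eq_one_or b with rfl | rfl <;>
    simp

lemma switch_fst_apply (q : PairPerm n) {i : Fin (n + 2)} (h0 : i ≠ 0) (hl : i ≠ lastF n) :
    (switch q).1 i = if (link q).SameCycle (lastF n) i then q.2 i else q.1 i := by
  simp only [switch, linkCycle, mul_apply, cycleOf_apply]
  split_ifs
  · rw [fst_link, swap_apply_of_ne_of_ne h0 hl]
  · rfl

lemma switch_snd_apply (q : PairPerm n) {i : Fin (n + 2)} (h0 : i ≠ 0) (hl : i ≠ lastF n) :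
    (switch q).2 i = if (link q).SameCycle (lastF n) i then q.1 i else q.2 i := by
  simp only [switch, linkCycle_inv, mul_apply, swap_apply_of_ne_of_ne h0 hl, cycleOf_apply,
    sameCycle_inv]
  split_ifs
  · rw [snd_swap_link_symm]
  · rw [swap_apply_of_ne_of_ne h0 hl]

lemma switch_fst_zero {q : PairPerm n} (h : ¬ (link q).SameCycle (lastF n) 0) :
    (switch q).1 0 = q.1 0 := by
  simp [switch, linkCycle, cycleOf_apply_of_not_sameCycle h]

lemma switch_snd_last {q : PairPerm n} (h : ¬ (link q).SameCycle (lastF n) 0) :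
    (switch q).2 (lastF n) = q.2 (lastF n) := by
  have h' : ¬ (link q)⁻¹.SameCycle (lastF n) 0 := by rwa [sameCycle_inv]
  simp only [switch, linkCycle_inv, mul_apply, swap_apply_right,
    cycleOf_apply_of_not_sameCycle h', swap_apply_left]

lemma wgt_switch (R : Type) [CommRing R] (A : Fin (n + 2) → Fin (n + 2) → R)
    {q : PairPerm n} (h : ¬ (link q).SameCycle (lastF n) 0) : wgt R A (switch q) = wgt R A q := by
  have hs : ∀ p : PairPerm n, ((sign p.1 : ℤ) : R) * ((sign p.2 : ℤ) : R)
      = ((sign p.1 * sign p.2 : ℤˣ) : ℤ) := fun p => by push_cast; rfl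
  have h1 : ∀ f : Fin (n + 2) → R, ∏ i ∈ Finset.univ.erase (lastF n), f i
      = f 0 * ∏ i ∈ middleF n, f i := fun f => by
    rw [middleF, Finset.erase_right_comm, Finset.mul_prod_erase]
    simp [(lastF_ne_zero n).symm]
  have h2 : ∀ f : Fin (n + 2) → R, ∏ i ∈ Finset.univ.erase 0, f i
      = f (lastF n) * ∏ i ∈ middleF n, f i := fun f => by
    rw [middleF, Finset.mul_prod_erase]
    simp [lastF_ne_zero n]
  have h3 : (∏ i ∈ middleF n, A i ((switch q).1 i)) * ∏ i ∈ middleF n, A i ((switch q).2 i)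
      = (∏ i ∈ middleF n, A i (q.1 i)) * ∏ i ∈ middleF n, A i (q.2 i) := by
    rw [← Finset.prod_mul_distrib, ← Finset.prod_mul_distrib]
    refine Finset.prod_congr rfl fun i hi => ?_
    simp only [middleF, Finset.mem_erase, Finset.mem_univ, and_true] at hi
    rw [switch_fst_apply q hi.2 hi.1, switch_snd_apply q hi.2 hi.1]
    split_ifs
    · exact mul_comm _ _
    · rfl
  rw [wgt, wgt, hs, hs, sign_switch, h1, h2, h1, h2, switch_fst_zero h, switch_snd_last h]
  linear_combination ((sign q.1 * sign q.2 : ℤˣ) : ℤ) * A 0 (q.1 0) * A (lastF n) (q.2 (lastF n))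
    * h3

lemma sameCycle_link_of_tStep {p q : PairPerm n} (hp : InA p) (h : TStep p q) :
    (link q).SameCycle (lastF n) 0 := by
  obtain ⟨r, hr, hne, -, -, -, hmar, hlast, haff, -⟩ := h
  have hm : ∀ k, k < r → chainM p k ≠ 0 := by
    rintro (_ | k) hk h0
    · exact lastF_ne_zero n h0
    · have : p.1 (chainM p k) = p.2 0 := by rw [← h0]; simp [chainM]
      exact (hne k hk).1 (this.trans hp.1)
  have hstep : ∀ k, k < r → (q.1⁻¹ * q.2) (chainM p k)
      = if k + 1 < r then chainM p (k + 1) else lastF n := by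
    intro k hk
    rw [mul_apply, haff k hk, inv_eq_iff_eq]
    split_ifs with hk'
    · exact (hmar k hk').symm
    · rw [hlast, show r - 1 = k by omega]
  have hlink : ∀ k, k < r → (link q).SameCycle 0
      (if k + 1 < r then chainM p (k + 1) else lastF n) := by
    intro k
    induction k with
    | zero =>
      intro hk
      rw [← hstep 0 hk, chainM, ← link_zero]
      exact sameCycle_apply_right.2 (SameCycle.refl _ _)
    | succ k ih =>
      intro hk
      have := ih (by omega)
      rw [if_pos hk] at this
      rw [← hstep _ hk]
      by_cases hl : chainM p (k + 1) = lastF n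
      · rw [hl, ← link_zero]
        exact sameCycle_apply_right.2 (SameCycle.refl _ _)
      · rw [← link_of_ne q (hm _ hk) hl]
        exact sameCycle_apply_right.2 this
  have := hlink (r - 1) (by omega)
  rw [if_neg (by omega)] at this
  exact this.symm

/-- If the alternating path from man `n` returns to the dummy marriage without meeting man `1`,
then the pair lies in the image of `T`. -/
lemma exists_tStep {q : PairPerm n} (hq : InB q ∨ InC q)
    (h : (link q).SameCycle (lastF n) 0) : ∃ p, InA p ∧ TStep p q := by
  have hl0 := lastF_ne_zero n
  set c : Perm (Fin (n + 2)) := q.1⁻¹ * q.2 with hc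
  have hqc : ∀ i, q.1 (c i) = q.2 i := fun i => by simp [hc]
  obtain ⟨r, ⟨hr, hrl⟩, hmin⟩ : ∃ r : ℕ, (0 < r ∧ (link q ^ r) 0 = lastF n) ∧
      ∀ k, k < r → 0 < k → (link q ^ k) 0 ≠ lastF n := by
    obtain ⟨k, hk⟩ := h.symm.exists_nat_pow_eq
    have hex : ∃ k : ℕ, 0 < k ∧ (link q ^ k) 0 = lastF n := by
      refine ⟨k, Nat.pos_of_ne_zero ?_, hk⟩
      rintro rfl
      exact hl0 hk.symm
    exact ⟨Nat.find hex, Nat.find_spec hex, fun k hk h0 h1 => Nat.find_min hex hk ⟨h0, h1⟩⟩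
  have hlk0 : ∀ k, k < r → 0 < k → (link q ^ k) 0 ≠ 0 := by
    intro k hk hk0 h0
    refine hmin (r - k) (by omega) (by omega) ?_
    rw [← hrl]
    conv_rhs => rw [show r = (r - k) + k by omega, pow_add, mul_apply, h0]
  have hpow : ∀ k, k < r → (link q ^ (k + 1)) 0 = (c ^ (k + 1)) (lastF n) := by
    intro k
    induction k with
    | zero => intro; exact link_zero q
    | succ k ih =>
      intro hk
      rw [pow_succ', mul_apply, pow_succ' c, mul_apply, ← ih (by omega)]
      exact link_of_ne q (hlk0 (k + 1) hk (by omega)) (hmin (k + 1) hk (by omega))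
  have hcr : (c ^ r) (lastF n) = lastF n := by
    obtain ⟨k, rfl⟩ : ∃ k, r = k + 1 := ⟨r - 1, by omega⟩
    rw [← hpow k (by omega), hrl]
  have hm0 : ∀ k, k < r → (c ^ k) (lastF n) ≠ 0 := by
    rintro (_ | k) hk
    · simpa using hl0
    · rw [← hpow k (by omega)]; exact hlk0 _ hk (by omega)
  have hml : ∀ k, k + 1 < r → (c ^ (k + 1)) (lastF n) ≠ lastF n := by
    intro k hk
    rw [← hpow k (by omega)]; exact hmin _ hk (by omega)
  have horb : ∀ i, c.SameCycle (lastF n) i → ∃ k, k < r ∧ i = (c ^ k) (lastF n) := by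
    intro i hi
    obtain ⟨k, rfl⟩ := hi.exists_nat_pow_eq
    refine ⟨k % r, Nat.mod_lt _ hr, ?_⟩
    have hper : ∀ j : ℕ, ((c ^ r) ^ j) (lastF n) = lastF n := by
      intro j
      induction j with
      | zero => rfl
      | succ j ih => rw [pow_succ, mul_apply, hcr, ih]
    conv_lhs => rw [← Nat.mod_add_div k r, pow_add, pow_mul, mul_apply, hper]
  have hc0 : ¬ c.SameCycle (lastF n) 0 := by
    intro h0
    obtain ⟨k, hk, hk0⟩ := horb 0 h0
    exact hm0 k hk hk0.symm
  set g := c.cycleOf (lastF n) with hg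
  have hgi : g⁻¹ = c⁻¹.cycleOf (lastF n) := cycleOf_inv _ _
  have hsc : ∀ k, q.2 ((c⁻¹) k) = q.1 k := fun k => by simp [← hqc]
  set p : PairPerm n := (q.1 * g, swap (q.1 (lastF n)) (lastF n) * q.2 * g⁻¹) with hp
  have hp1 : ∀ i, c.SameCycle (lastF n) i → p.1 i = q.2 i := fun i hi => by
    simp [hp, hg, hi.cycleOf_apply, hqc]
  have hp1' : ∀ i, ¬ c.SameCycle (lastF n) i → p.1 i = q.1 i := fun i hi => by
    simp [hp, hg, cycleOf_apply_of_not_sameCycle hi]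
  have hp2 : ∀ i, c.SameCycle (lastF n) i →
      p.2 i = swap (q.1 (lastF n)) (lastF n) (q.1 i) := fun i hi => by
    have hi' : c⁻¹.SameCycle (lastF n) i := sameCycle_inv.2 hi
    rw [hp]
    simp only [hgi, mul_apply, hi'.cycleOf_apply, hsc]
  have hp2' : ∀ i, ¬ c.SameCycle (lastF n) i →
      p.2 i = swap (q.1 (lastF n)) (lastF n) (q.2 i) := fun i hi => by
    have hi' : ¬ c⁻¹.SameCycle (lastF n) i := fun h => hi (sameCycle_inv.1 h)
    rw [hp]
    simp only [hgi, mul_apply, cycleOf_apply_of_not_sameCycle hi']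
  have hend : ∀ w, w ≠ q.1 (lastF n) → w ≠ q.2 0 → w ≠ 0 ∧ w ≠ lastF n := by
    intro w h1 h2
    rcases hq with ⟨e1, e2⟩ | ⟨e1, e2⟩ <;> rw [e1] at h1 <;> rw [e2] at h2
    · exact ⟨h2, h1⟩
    · exact ⟨h1, h2⟩
  have hsame : ∀ k : ℕ, c.SameCycle (lastF n) ((c ^ k) (lastF n)) := fun k => ⟨k, rfl⟩
  have hqpow : ∀ k : ℕ, q.2 ((c ^ k) (lastF n)) = q.1 ((c ^ (k + 1)) (lastF n)) := fun k => by
    rw [pow_succ', mul_apply, hqc]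
  have hwne : ∀ k, k + 1 < r → q.2 ((c ^ k) (lastF n)) ≠ q.1 (lastF n) := by
    intro k hk he
    rw [hqpow] at he
    exact hml k hk (q.1.injective he)
  have hwmid : ∀ k, k + 1 < r → q.2 ((c ^ k) (lastF n)) ≠ 0 ∧ q.2 ((c ^ k) (lastF n)) ≠ lastF n :=
    fun k hk => hend _ (hwne k hk) fun he => hm0 k (by omega) (q.2.injective he)
  have hchain : ∀ k, k < r → chainM p k = (c ^ k) (lastF n) := by
    intro k
    induction k with
    | zero => intro; rfl
    | succ k ih =>
      intro hk
      rw [chainM, ih (by omega), Equiv.symm_apply_eq, hp1 _ (hsame k), hp2 _ (hsame _),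
        ← hqpow, swap_apply_of_ne_of_ne (hwne k hk) (hwmid k hk).2]
  have hchainW : ∀ k, k < r → chainW p k = q.2 ((c ^ k) (lastF n)) := fun k hk => by
    rw [chainW, hchain k hk, hp1 _ (hsame k)]
  have hwlast : chainW p (r - 1) = q.1 (lastF n) := by
    rw [hchainW _ (by omega), hqpow, Nat.sub_add_cancel hr, hcr]
  have hoff : ∀ i, (∀ k, k < r → i ≠ chainM p k) → ¬ c.SameCycle (lastF n) i := by
    intro i hi his
    obtain ⟨k, hk, rfl⟩ := horb i his
    exact hi k hk (hchain k hk).symm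
  refine ⟨p, ⟨?_, ?_⟩, r, hr, fun k hk => ?_, ?_, fun i hi => ?_, fun i hi0 hi => ?_,
    fun k hk => ?_, ?_, fun k hk => ?_, ?_⟩
  · rw [hp2' _ hc0]
    rcases hq with ⟨e1, e2⟩ | ⟨e1, e2⟩ <;> simp [e1, e2]
  · rw [hp2 _ (SameCycle.refl _ _), swap_apply_left]
  · rw [hchainW k (by omega)]
    exact hwmid k hk
  · rw [hwlast]
    exact hq.symm.imp And.left And.left
  · exact (hp1' i (hoff i hi)).symm
  · have h1 : q.2 i ≠ q.1 (lastF n) := by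
      rw [← hwlast, hchainW _ (by omega)]
      intro he
      refine hi (r - 1) (by omega) ?_
      rw [hchain _ (by omega)]
      exact q.2.injective he
    rw [hp2' i (hoff i hi), swap_apply_of_ne_of_ne h1
      (hend _ h1 fun he => hi0 (q.2.injective he)).2]
  · rw [hchain _ hk, hchainW _ (by omega), hqpow]
  · exact hwlast.symm
  · rw [hchain k hk, hchainW k hk]
  · rw [hwlast]
    rcases hq with ⟨e1, e2⟩ | ⟨e1, e2⟩ <;> simp [e1, e2, hl0]

lemma not_sameCycle_link {q : PairPerm n} (hq : InB q ∨ InC q) (hb : IsBad q) :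
    ¬ (link q).SameCycle (lastF n) 0 := fun h => hb (exists_tStep hq h)

lemma isBad_switch {q : PairPerm n} (hq : InB q ∨ InC q) (hb : IsBad q) :
    IsBad (switch q) := by
  rintro ⟨p, hp, ht⟩
  exact not_sameCycle_link hq hb (sameCycle_link_of_switch (sameCycle_link_of_tStep hp ht))

lemma badB_switch {q : PairPerm n} (hq : BadC q) : BadB (switch q) :=
  ⟨inB_switch hq.1, isBad_switch (Or.inr hq.1) hq.2⟩

lemma badC_switch {q : PairPerm n} (hq : BadB q) : BadC (switch q) :=
  ⟨inC_switch hq.1, isBad_switch (Or.inl hq.1) hq.2⟩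

end PairPerm

open scoped Classical in
/-- There is a weight-reversing bijection `S` from the bad elements of `C(n)` to the
bad elements of `B(n)`: for every matrix `A`, the weight of `S q` is the negative of
the weight of `q` (where elements of `C(n)` carry an extra factor `-1`).
Consequently the total weight of all bad elements is zero. -/
theorem bad_elements_cancel (n : ℕ) :
    ∃ S : PairPerm n → PairPerm n,
      (∀ q, BadC q → BadB (S q)) ∧
      (∀ q q', BadC q → BadC q' → S q = S q' → q = q') ∧
      (∀ b, BadB b → ∃ q, BadC q ∧ S q = b) ∧
      (∀ q, BadC q → ∀ (R : Type) [CommRing R] (A : Fin (n + 2) → Fin (n + 2) → R),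
        wgt R A (S q) = -((-1 : R) * wgt R A q)) ∧
      (∀ (R : Type) [CommRing R] (A : Fin (n + 2) → Fin (n + 2) → R),
        (∑ q ∈ Finset.univ.filter BadB, wgt R A q) +
          (∑ q ∈ Finset.univ.filter BadC, (-1 : R) * wgt R A q) = 0) := by
  have hw : ∀ q, BadC q → ∀ (R : Type) [CommRing R] (A : Fin (n + 2) → Fin (n + 2) → R),
      wgt R A (PairPerm.switch q) = -((-1 : R) * wgt R A q) := fun q hq R _ A => by
    rw [PairPerm.wgt_switch R A (PairPerm.not_sameCycle_link (Or.inr hq.1) hq.2)]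
    ring
  refine ⟨PairPerm.switch, fun q => PairPerm.badB_switch, fun q q' _ _ h => ?_,
    fun b hb => ⟨PairPerm.switch b, PairPerm.badC_switch hb, PairPerm.switch_switch b⟩, hw,
    fun R _ A => ?_⟩
  · rw [← PairPerm.switch_switch q, h, PairPerm.switch_switch]
  · rw [← eq_neg_iff_add_eq_zero, ← Finset.sum_neg_distrib, eq_comm]
    refine Finset.sum_nbij' PairPerm.switch PairPerm.switch ?_ ?_
      (fun q _ => PairPerm.switch_switch q) (fun q _ => PairPerm.switch_switch q) ?_
    · intro q hq
      simpa using PairPerm.badB_switch (by simpa using hq)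
    · intro q hq
      simpa using PairPerm.badC_switch (by simpa using hq)
    · intro q hq
      exact (hw q (by simpa using hq) R A).symm
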